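/- A non-degenerate linear recurrence sequence over a field of characteristic zero that is not identically zero has only finitely many zero terms. -/

import Mathlib

open Polynomial

theorem sml_poly_vanish {S : Type*} [CommRing S] [IsDomain S] [CharZero S] (p : ℕ)
    (hfac : ∀ k : ℕ, ((k.factorial : ℕ) : S) ∣ (p : S) ^ k)
    (hsep : ∀ x : S, (∀ j : ℕ, (p : S) ^ j ∣ x) → x = 0)
    (b : ℕ → S)
    (hinf : {n : ℕ | ∑ k ∈ Finset.range (n + 1), (n.choose k : S) * ((p : S) ^ (2 * k) * b k) = 0}.Infinite)
    (m : ℕ) : ∑ k ∈ Finset.range (m + 1), (m.choose k : S) * ((p : S) ^ (2 * k) * b k) = 0 := by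
  choose e he using hfac
  set f : ℕ → S := fun n => ∑ k ∈ Finset.range (n + 1), (n.choose k : S) * ((p : S) ^ (2 * k) * b k) with hf
  let P : ℕ → S[X] := fun L => ∑ k ∈ Finset.range (L + 1), C ((p : S) ^ k * (e k * b k)) * descPochhammer S k
  have hP : ∀ L n : ℕ, n ≤ L → (P L).eval (n : S) = f n := by
    intro L n hn
    have h1 : ∀ k, (C ((p : S) ^ k * (e k * b k)) * descPochhammer S k).eval (n : S)
        = (n.choose k : S) * ((p : S) ^ (2 * k) * b k) := by
      intro k
      rw [eval_mul, eval_C, descPochhammer_eval_eq_descFactorial, Nat.descFactorial_eq_factorial_mul_choose]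
      push_cast
      rw [two_mul, pow_add]
      nth_rewrite 3 [he k]
      ring
    simp only [P, eval_finsetSum, h1, hf]
    symm
    apply Finset.sum_subset
    · intro k hk; simp at hk ⊢; omega
    · intro k _ hk
      have : n < k := by
        rw [Finset.mem_range] at hk; omega
      simp [Nat.choose_eq_zero_of_lt this]
  apply hsep
  intro j
  obtain ⟨t, hts, htc⟩ := Set.Infinite.exists_subset_card_eq hinf j
  let L := max m (t.sup id)
  have hmL : (P L).eval (m : S) = f m := hP L m (le_max_left _ _)
  change (p : S) ^ j ∣ f m
  rw [← hmL]
  let W : S[X] := ∏ n ∈ t, (X - C ((n : ℕ) : S))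
  have hWm : W.Monic := monic_prod_of_monic _ _ fun n _ => monic_X_sub_C _
  have hWd : W.degree = j := by
    rw [degree_prod, Finset.sum_congr rfl fun (n : ℕ) _ => degree_X_sub_C (n : S)]; simp [htc]
  have hprod : W ∣ P L := by
    by_cases h0 : P L = 0
    · rw [h0]; exact dvd_zero _
    refine dvd_trans ?_ (prod_multiset_X_sub_C_dvd (P L))
    have : W = ((t.val.map (fun n : ℕ => (n : S))).map (fun x => X - C x)).prod := by
      rw [Multiset.map_map]; rfl
    rw [this]
    apply Multiset.prod_dvd_prod_of_le
    apply Multiset.map_le_map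
    rw [Multiset.le_iff_subset (t.nodup.map Nat.cast_injective)]
    intro x hx
    obtain ⟨n, hn, rfl⟩ := Multiset.mem_map.1 hx
    rw [mem_roots h0, IsRoot, hP L n (le_trans (Finset.le_sup (f := id) hn) (le_max_right _ _))]
    exact hts hn
  obtain ⟨A, B, hA, hAB⟩ : ∃ A B : S[X], A.degree < j ∧ P L = A + (p : S) ^ j • B := by
    have key : ∀ k, ∃ A B : S[X], A.degree < j ∧
        C ((p : S) ^ k * (e k * b k)) * descPochhammer S k = A + (p : S) ^ j • B := by
      intro k
      by_cases hk : k < j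
      · refine ⟨_, 0, ?_, by rw [smul_zero, add_zero]⟩
        refine degree_le_natDegree.trans_lt ?_
        refine lt_of_le_of_lt (b := (k : WithBot ℕ)) ?_ ?_
        · have := natDegree_C_mul_le ((p : S) ^ k * (e k * b k)) (descPochhammer S k)
          rw [descPochhammer_natDegree] at this
          exact_mod_cast this
        exact_mod_cast hk
      · refine ⟨0, C ((p : S) ^ (k - j) * (e k * b k)) * descPochhammer S k, ?_, ?_⟩
        · rw [degree_zero]; exact WithBot.bot_lt_coe _
        · rw [zero_add, smul_eq_C_mul, ← mul_assoc (C _) (C _), ← C_mul, ← mul_assoc (_ ^ _) (_ ^ _),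
            ← pow_add, Nat.add_sub_cancel' (not_lt.1 hk)]
    choose A B hA hAB using key
    refine ⟨∑ k ∈ Finset.range (L + 1), A k, ∑ k ∈ Finset.range (L + 1), B k, ?_, ?_⟩
    · rw [← mem_degreeLT]
      exact Submodule.sum_mem _ fun k _ => mem_degreeLT.2 (hA k)
    · simp only [P, hAB, Finset.sum_add_distrib, Finset.smul_sum]
  have hmod := (modByMonic_eq_zero_iff_dvd hWm).2 hprod
  rw [hAB, add_modByMonic, smul_modByMonic, (modByMonic_eq_self_iff hWm).2 (by rwa [hWd])] at hmod
  have : P L = (p : S) ^ j • (B - B %ₘ W) := by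
    rw [hAB, smul_sub, eq_neg_of_add_eq_zero_left hmod]; abel
  rw [this, eval_smul, smul_eq_mul]
  exact dvd_mul_right _ _

theorem sml_expand_card (N : ℕ) (hN : 0 < N) (s : Multiset ℂ) :
    (∀ x ∈ s, x ≠ 0) → (∀ x ∈ s, ∀ y ∈ s, x ^ N = y ^ N → x = y) →
    ∀ h : ℂ[X], (s.map (fun x => X - C x)).prod ∣ expand ℂ N h → h ≠ 0 →
      s.card ≤ h.natDegree := by
  induction s using Multiset.induction_on with
  | empty => intros; simp
  | cons l s ih =>
    intro h0 hinj h hd hh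
    rw [Multiset.map_cons, Multiset.prod_cons] at hd
    have hroot : h.IsRoot (l ^ N) := by
      have := (dvd_iff_isRoot.1 ((dvd_mul_right _ _).trans hd))
      simpa [IsRoot, expand_eval] using this
    obtain ⟨h1, rfl⟩ := dvd_iff_isRoot.2 hroot
    have h1ne : h1 ≠ 0 := right_ne_zero_of_mul hh
    obtain ⟨q, hq⟩ : (X - C l : ℂ[X]) ∣ X ^ N - C (l ^ N) := by
      rw [dvd_iff_isRoot]; simp
    have hexp : expand ℂ N ((X - C (l ^ N)) * h1) = (X - C l) * (q * expand ℂ N h1) := by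
      rw [map_mul, map_sub, expand_X, expand_C, hq, mul_assoc]
    rw [hexp] at hd
    have hd2 := (mul_dvd_mul_iff_left (X_sub_C_ne_zero l)).1 hd
    have hql : ∀ y ∈ l ::ₘ s, q.eval y ≠ 0 := by
      intro y hy hqy
      by_cases hyl : y = l
      · subst hyl
        have := congrArg (fun r => (derivative r).eval y) hq
        simp only [derivative_sub, derivative_X_pow, derivative_C, derivative_mul, eval_sub, eval_add,
          eval_mul, eval_C, eval_pow, eval_X, derivative_X, hqy, eval_zero, eval_one] at this
        simp at this
        rcases this with h | h
        · omega
        · exact h0 y hy h.1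
      · have := congrArg (fun r => r.eval y) hq
        simp [hqy] at this
        exact hyl (hinj y hy l (Multiset.mem_cons_self _ _) (sub_eq_zero.1 this))
    have hcop : IsCoprime (s.map (fun x => X - C x)).prod q := by
      have hgen : ∀ s' : Multiset ℂ[X], (∀ f ∈ s', IsCoprime f q) → IsCoprime s'.prod q := by
        intro s'
        induction s' using Multiset.induction_on with
        | empty => intro _; simpa using isCoprime_one_left
        | cons f s' ih' =>
          intro hs'
          rw [Multiset.prod_cons]
          exact (hs' f (Multiset.mem_cons_self _ _)).mul_left
            (ih' fun g hg => hs' g (Multiset.mem_cons_of_mem hg))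
      apply hgen
      intro f hf
      obtain ⟨y, hy, rfl⟩ := Multiset.mem_map.1 hf
      rw [(irreducible_X_sub_C y).coprime_iff_not_dvd, dvd_iff_isRoot]
      exact hql y (Multiset.mem_cons_of_mem hy)
    have hd3 := hcop.dvd_of_dvd_mul_left hd2
    have := ih (fun x hx => h0 x (Multiset.mem_cons_of_mem hx))
      (fun x hx y hy => hinj x (Multiset.mem_cons_of_mem hx) y (Multiset.mem_cons_of_mem hy)) h1 hd3 h1ne
    rw [natDegree_mul (X_sub_C_ne_zero _) h1ne, natDegree_X_sub_C, Multiset.card_cons]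
    omega

theorem sml_surj (N : ℕ) (hN : 0 < N) (χ : ℂ[X]) (hm : χ.Monic)
    (h0 : ∀ x, χ.IsRoot x → x ≠ 0) (hinj : ∀ x y, χ.IsRoot x → χ.IsRoot y → x ^ N = y ^ N → x = y)
    (f : ℂ[X]) : ∃ h : ℂ[X], χ ∣ f - expand ℂ N h := by
  have hprod : (χ.roots.map (fun x => X - C x)).prod = χ := by
    have := (IsAlgClosed.splits χ).eq_prod_roots
    rw [hm.leadingCoeff] at this
    simpa using this.symm
  have hcard : χ.roots.card = χ.natDegree := (IsAlgClosed.splits χ).natDegree_eq_card_roots.symm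
  have : Module.Finite ℂ (AdjoinRoot χ) := hm.finite_adjoinRoot
  have hfr : Module.finrank ℂ (AdjoinRoot χ) = χ.natDegree := by
    rw [(AdjoinRoot.powerBasis hm.ne_zero).finrank, AdjoinRoot.powerBasis_dim]
  let T : degreeLT ℂ χ.natDegree →ₗ[ℂ] AdjoinRoot χ :=
    ((AdjoinRoot.mkₐ χ).comp (expand ℂ N)).toLinearMap.comp (degreeLT ℂ χ.natDegree).subtype
  have hfr2 : Module.finrank ℂ (degreeLT ℂ χ.natDegree) = χ.natDegree := by
    rw [(degreeLTEquiv ℂ χ.natDegree).finrank_eq]; simp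
  have : Module.Finite ℂ (degreeLT ℂ χ.natDegree) := Module.Finite.equiv (degreeLTEquiv ℂ χ.natDegree).symm
  have hTi : Function.Injective T := by
    rw [injective_iff_map_eq_zero]
    rintro ⟨h, hh⟩ hT
    by_contra hne
    have hne' : h ≠ 0 := fun H => hne (by simpa using H)
    have hd : χ ∣ expand ℂ N h := AdjoinRoot.mk_eq_zero.1 hT
    rw [← hprod] at hd
    have := sml_expand_card N hN χ.roots (fun x hx => h0 x (isRoot_of_mem_roots hx))
      (fun x hx y hy => hinj x y (isRoot_of_mem_roots hx) (isRoot_of_mem_roots hy)) h hd hne'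
    rw [hcard] at this
    rw [mem_degreeLT, degree_eq_natDegree hne'] at hh
    have : h.natDegree < χ.natDegree := by exact_mod_cast hh
    omega
  have hTs := (LinearMap.injective_iff_surjective_of_finrank_eq_finrank (hfr2.trans hfr.symm)).1 hTi
  obtain ⟨⟨h, _⟩, hT⟩ := hTs (AdjoinRoot.mk χ f)
  refine ⟨h, ?_⟩
  rw [← AdjoinRoot.mk_eq_zero, map_sub, ← hT]
  exact sub_self _

/-- the functional X^n ↦ u n -/
noncomputable def smlFun {S : Type*} [CommRing S] (u : ℕ → S) : S[X] →ₗ[S] S :=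
  Polynomial.lsum (fun n => LinearMap.lsmul S S (u n)) 

theorem smlFun_mon {S : Type*} [CommRing S] (u : ℕ → S) (n : ℕ) : smlFun u (X ^ n) = u n := by
  rw [X_pow_eq_monomial]
  simp [smlFun]

theorem smlFun_ideal {S : Type*} [CommRing S] (u : ℕ → S) (d : ℕ) (a : Fin d → S)
    (hrec : ∀ n : ℕ, u (n + d) = ∑ i : Fin d, a i * u (n + i)) (f : S[X])
    (hf : (X ^ d - ∑ i : Fin d, C (a i) * X ^ (i : ℕ)) ∣ f) : smlFun u f = 0 := by
  obtain ⟨g, rfl⟩ := hf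
  induction g using Polynomial.induction_on' with
  | add p q hp hq => rw [mul_add, map_add, hp, hq, add_zero]
  | monomial n c =>
    have : (X ^ d - ∑ i : Fin d, C (a i) * X ^ (i : ℕ)) * monomial n c =
      c • (X ^ (n + d) - ∑ i : Fin d, (a i) • X ^ (n + i : ℕ)) := by
      rw [← C_mul_X_pow_eq_monomial, smul_eq_C_mul, sub_mul, mul_sub, Finset.sum_mul, Finset.mul_sum]
      congr 1
      · ring
      · refine Finset.sum_congr rfl fun i _ => ?_
        rw [smul_eq_C_mul]; ring
    rw [this, map_smul, map_sub, map_sum, smlFun_mon, hrec]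
    simp [smlFun_mon]

theorem sml_monic {S : Type*} [CommRing S] [Nontrivial S] (d : ℕ) (a : Fin d → S) :
   (X ^ d - ∑ i : Fin d, C (a i) * X ^ (i : ℕ)).Monic ∧ 
   (X ^ d - ∑ i : Fin d, C (a i) * X ^ (i : ℕ)).natDegree = d := by
  have hlt : degree (∑ i : Fin d, C (a i) * X ^ (i : ℕ)) < (d : WithBot ℕ) := by
    rw [← Polynomial.mem_degreeLT]
    refine Submodule.sum_mem _ fun i _ => ?_
    rw [Polynomial.mem_degreeLT]
    exact (degree_C_mul_X_pow_le _ _).trans_lt (by exact_mod_cast i.2)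
  refine ⟨monic_X_pow_sub hlt, ?_⟩
  apply natDegree_eq_of_degree_eq_some
  rw [degree_sub_eq_left_of_degree_lt] <;> simp [hlt]

theorem sml_nondeg (d : ℕ) (a : Fin d → ℂ) (ha : ∀ h : 0 < d, a ⟨0, h⟩ ≠ 0)
    (Xs : ℕ → ℂ)
    (hrec : ∀ n : ℕ, Xs (n + d) = ∑ i : Fin d, a i * Xs (n + i))
    (hnonzero : ∃ n : ℕ, Xs n ≠ 0)
    (hND : ∀ lam mu : ℂ,
      (X ^ d - ∑ i : Fin d, C (a i) * X ^ (i : ℕ)).IsRoot lam →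
      (X ^ d - ∑ i : Fin d, C (a i) * X ^ (i : ℕ)).IsRoot mu →
      lam ≠ mu → ∀ n : ℕ, 0 < n → (lam / mu) ^ n ≠ 1)
    (N r : ℕ) (hN : 0 < N) (hz : ∀ n, Xs (r + N * n) = 0) : False := by
  obtain ⟨hm, hdeg⟩ := sml_monic d a
  have hid := smlFun_ideal Xs d a hrec
  set χ : ℂ[X] := X ^ d - ∑ i : Fin d, C (a i) * X ^ (i : ℕ) with hχ
  have hroot0 : ¬ χ.IsRoot 0 := by
    rcases Nat.eq_zero_or_pos d with h | h
    · subst h; simp [hχ]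
    · intro h0
      obtain ⟨d', rfl⟩ : ∃ d', d = d' + 1 := ⟨d - 1, by omega⟩
      simp [hχ, eval_finsetSum, Fin.sum_univ_succ] at h0
      exact ha h h0
  have hcop : IsCoprime χ (X ^ r) := by
    apply IsCoprime.pow_right
    apply IsCoprime.symm
    rw [irreducible_X.coprime_iff_not_dvd, ← sub_zero X, ← C_0, dvd_iff_isRoot]
    exact hroot0
  have hne : ∀ x, χ.IsRoot x → x ≠ 0 := by
    rintro x hx rfl; exact hroot0 hx
  have hinj : ∀ x y, χ.IsRoot x → χ.IsRoot y → x ^ N = y ^ N → x = y := by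
    intro x y hx hy hxy
    by_contra hc
    apply hND x y hx hy hc N hN
    rw [div_pow, hxy, div_self (pow_ne_zero _ (hne y hy))]
  obtain ⟨n, hn⟩ := hnonzero
  apply hn
  obtain ⟨u, v, huv⟩ := hcop
  obtain ⟨h, hh⟩ := sml_surj N hN χ hm hne hinj (v * X ^ n)
  have hzero : ∀ h : ℂ[X], smlFun Xs (X ^ r * expand ℂ N h) = 0 := by
    intro h
    induction h using Polynomial.induction_on' with
    | add p q hp hq => rw [map_add, mul_add, map_add, hp, hq, add_zero]
    | monomial k c =>
      rw [expand_monomial, ← C_mul_X_pow_eq_monomial, mul_left_comm, ← smul_eq_C_mul, map_smul,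
        ← pow_add, smlFun_mon, mul_comm k N, hz, smul_zero]
  have hX : X ^ n = χ * (u * X ^ n) + X ^ r * (v * X ^ n - expand ℂ N h) + X ^ r * expand ℂ N h := by
    calc X ^ n = (u * χ + v * X ^ r) * X ^ n := by rw [huv, one_mul]
      _ = _ := by ring
  rw [← smlFun_mon Xs n, hX, map_add, map_add, hzero, hid _ (dvd_mul_right _ _),
    hid _ (hh.mul_left _)]
  simp

theorem sml_period {S : Type*} [CommRing S] (c : S) [Finite (S ⧸ Ideal.span {c})]
    (χ : S[X]) (hm : χ.Monic) (h0 : IsUnit (χ.coeff 0)) :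
    ∃ N : ℕ, 0 < N ∧ ∃ β : S[X], χ ∣ X ^ N - (C c * β + 1) := by
  let π := Ideal.Quotient.mk (Ideal.span {c})
  let χ' := χ.map π
  have : Module.Finite (S ⧸ Ideal.span {c}) (AdjoinRoot χ') := (hm.map π).finite_adjoinRoot
  have : Finite (AdjoinRoot χ') := Module.finite_of_finite (S ⧸ Ideal.span {c})
  have hu : IsUnit (AdjoinRoot.mk χ' X) := by
    obtain ⟨w, hw⟩ := X_dvd_sub_C (p := χ')
    have h1 : AdjoinRoot.mk χ' X * AdjoinRoot.mk χ' w = - AdjoinRoot.mk χ' (C (χ'.coeff 0)) := by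
      rw [← map_mul, ← hw, map_sub, AdjoinRoot.mk_self, zero_sub]
    have h2 : IsUnit (AdjoinRoot.mk χ' X * AdjoinRoot.mk χ' w) := by
      rw [h1, coeff_map]
      exact (((h0.map π).map C).map (AdjoinRoot.mk χ')).neg
    exact isUnit_of_mul_isUnit_left h2
  obtain ⟨x, hx⟩ := hu
  refine ⟨orderOf x, orderOf_pos x, ?_⟩
  have h1 : AdjoinRoot.mk χ' (X ^ orderOf x - 1) = 0 := by
    rw [map_sub, map_pow, ← hx, ← Units.val_pow_eq_pow_val, pow_orderOf_eq_one]; simp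
  obtain ⟨g', hg'⟩ := AdjoinRoot.mk_eq_zero.1 h1
  obtain ⟨g, rfl⟩ := map_surjective π Ideal.Quotient.mk_surjective g'
  have h2 : (X ^ orderOf x - 1 - χ * g).map π = 0 := by
    rw [Polynomial.map_sub, Polynomial.map_mul, Polynomial.map_sub, Polynomial.map_pow, map_X,
      Polynomial.map_one, hg', sub_self]
  obtain ⟨β, hβ⟩ : C c ∣ X ^ orderOf x - 1 - χ * g := by
    rw [C_dvd_iff_dvd_coeff]
    intro i
    have := congrArg (fun q => q.coeff i) h2
    simp only [coeff_map, coeff_zero] at this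
    exact Ideal.mem_span_singleton.1 (Ideal.Quotient.eq_zero_iff_mem.1 this)
  refine ⟨β, g, ?_⟩
  rw [← hβ]; ring

theorem sml_progression {S : Type*} [CommRing S] [IsDomain S] [CharZero S] (p : ℕ)
    (hfac : ∀ k : ℕ, ((k.factorial : ℕ) : S) ∣ (p : S) ^ k)
    (hsep : ∀ x : S, (∀ j : ℕ, (p : S) ^ j ∣ x) → x = 0)
    (hfin : Finite (S ⧸ Ideal.span {(p : S) ^ 2}))
    (d : ℕ) (a : Fin d → S) (hd : 0 < d) (ha : IsUnit (a ⟨0, hd⟩)) (u : ℕ → S)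
    (hrec : ∀ n : ℕ, u (n + d) = ∑ i : Fin d, a i * u (n + i))
    (hinf : {n : ℕ | u n = 0}.Infinite) :
    ∃ N r : ℕ, 0 < N ∧ ∀ n, u (r + N * n) = 0 := by
  obtain ⟨hm, -⟩ := sml_monic d a
  have hid := smlFun_ideal u d a hrec
  have hc : IsUnit ((X ^ d - ∑ i : Fin d, C (a i) * X ^ (i : ℕ) : S[X]).coeff 0) := by
    obtain ⟨d', rfl⟩ : ∃ d', d = d' + 1 := ⟨d - 1, by omega⟩
    have : (X ^ (d' + 1) - ∑ i : Fin (d' + 1), C (a i) * X ^ (i : ℕ) : S[X]).coeff 0 = - a 0 := by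
      rw [coeff_zero_eq_eval_zero]
      simp [eval_finsetSum, Fin.sum_univ_succ]
    rw [this]
    exact ha.neg
  obtain ⟨N, hN, β, hβ⟩ := sml_period ((p : S) ^ 2) _ hm hc
  have hr : ∃ r, {n : ℕ | u (r + N * n) = 0}.Infinite := by
    by_contra! hcon
    apply hinf
    refine Set.Finite.subset (s := ⋃ r ∈ Set.Iio N, (fun n => r + N * n) '' {n : ℕ | u (r + N * n) = 0}) ?_ ?_
    · exact Set.Finite.biUnion (Set.finite_Iio N) fun r _ => (hcon r).image _
    · intro n hn
      simp only [Set.mem_iUnion]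
      refine ⟨n % N, Nat.mod_lt _ hN, n / N, ?_, Nat.mod_add_div _ _⟩
      simpa [Nat.mod_add_div] using hn
  obtain ⟨r, hr⟩ := hr
  refine ⟨N, r, hN, ?_⟩
  have hform : ∀ n, u (r + N * n) =
      ∑ k ∈ Finset.range (n + 1), (n.choose k : S) * ((p : S) ^ (2 * k) * smlFun u (X ^ r * β ^ k)) := by
    intro n
    have h1 : X ^ (r + N * n) = X ^ r * ((X ^ N) ^ n - (C ((p : S) ^ 2) * β + 1) ^ n)
        + X ^ r * (C ((p : S) ^ 2) * β + 1) ^ n := by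
      rw [pow_add, pow_mul]; ring
    rw [← smlFun_mon u, h1, map_add, hid _ ((hβ.trans (sub_dvd_pow_sub_pow _ _ n)).mul_left _), zero_add,
      add_pow, Finset.mul_sum, map_sum]
    refine Finset.sum_congr rfl fun k _ => ?_
    have : X ^ r * ((C ((p : S) ^ 2) * β) ^ k * 1 ^ (n - k) * (n.choose k : S[X])) =
        ((n.choose k : S) * (p : S) ^ (2 * k)) • (X ^ r * β ^ k) := by
      rw [smul_eq_C_mul, pow_mul]; simp; ring
    rw [this, map_smul, smul_eq_mul, mul_assoc]
  intro n
  rw [hform]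
  refine sml_poly_vanish p hfac hsep _ ?_ n
  simpa only [hform] using hr

theorem sml_algInd (p : ℕ) [Fact p.Prime] (s : ℕ) : ∃ τ : Fin s → ℤ_[p], AlgebraicIndependent ℤ τ := by
  obtain ⟨B, hB⟩ := exists_isTranscendenceBasis ℤ ℤ_[p]
  have hunc : ¬ Countable ℤ_[p] := by
    intro hc
    have h1 := Cardinal.mk_le_aleph0_iff.2 hc
    have h2 := continuum_le_cardinal_of_nontriviallyNormedField ℚ_[p]
    have h3 := IsLocalization.cardinalMk_le (L := ℚ_[p]) (nonZeroDivisors ℤ_[p])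
    exact absurd ((h2.trans h3).trans h1) (not_le.2 Cardinal.aleph0_lt_continuum)
  have hinf : B.Infinite := by
    intro hfin
    apply hunc
    have := hfin.to_subtype
    have hc : Countable (Algebra.adjoin ℤ (Set.range ((↑) : B → ℤ_[p]))) :=
      hB.1.aevalEquiv.symm.toEquiv.countable_iff.2
        (Cardinal.mk_le_aleph0_iff.1 (MvPolynomial.cardinalMk_le_max.trans (by simp)))
    have := hB.isAlgebraic
    have h4 := Algebra.IsAlgebraic.cardinalMk_le_max (Algebra.adjoin ℤ (Set.range ((↑) : B → ℤ_[p]))) ℤ_[p]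
    rw [max_eq_right (Cardinal.mk_le_aleph0_iff.2 hc)] at h4
    exact Cardinal.mk_le_aleph0_iff.1 h4
  have := hinf.to_subtype
  obtain ⟨e⟩ : Nonempty (Fin s ↪ B) := ⟨Fin.valEmbedding.trans (Infinite.natEmbedding B)⟩
  exact ⟨_, hB.1.comp e e.injective⟩

theorem sml_natUnit (p : ℕ) [hp : Fact p.Prime] (m : ℕ) (hm : ¬ p ∣ m) : IsUnit (m : ℤ_[p]) := by
  rw [PadicInt.isUnit_iff, PadicInt.norm_natCast_eq_one_iff]
  exact (Nat.Prime.coprime_iff_not_dvd hp.out).2 hm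

theorem sml_fac (p : ℕ) [hp : Fact p.Prime] (k : ℕ) : ((k.factorial : ℕ) : ℤ_[p]) ∣ (p : ℤ_[p]) ^ k := by
  obtain ⟨v, m, hm, h⟩ := Nat.exists_eq_pow_mul_and_not_dvd k.factorial_ne_zero p hp.out.ne_one
  have hv : v ≤ k := by
    refine le_trans ?_ (padicValNat_factorial_le p k)
    rw [← padicValNat_dvd_iff_le k.factorial_ne_zero, h]
    exact dvd_mul_right _ _
  rw [h]
  push_cast
  rw [(sml_natUnit p m hm).mul_right_dvd]
  exact pow_dvd_pow _ hv

theorem sml_local (p : ℕ) [hp : Fact p.Prime] (S : Type) [CommRing S] [IsDomain S] [Algebra ℤ_[p] S]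
    [Module.Finite ℤ_[p] S] (hinj : Function.Injective (algebraMap ℤ_[p] S)) :
    CharZero S ∧ (∀ k : ℕ, ((k.factorial : ℕ) : S) ∣ (p : S) ^ k) ∧
    (∀ x : S, (∀ j : ℕ, (p : S) ^ j ∣ x) → x = 0) ∧ Finite (S ⧸ Ideal.span {(p : S) ^ 2}) := by
  refine ⟨charZero_of_injective_algebraMap hinj, fun k => ?_, ?_, ?_⟩
  · simpa using map_dvd (algebraMap ℤ_[p] S) (sml_fac p k)
  · have : IsNoetherianRing S := IsNoetherianRing.of_finite ℤ_[p] S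
    have hne : Ideal.span {(p : S)} ≠ ⊤ := by
      rw [Ne, Ideal.span_singleton_eq_top]
      intro hu
      have : FaithfulSMul ℤ_[p] S := (faithfulSMul_iff_algebraMap_injective _ _).2 hinj
      have h1 : IsUnit (algebraMap ℤ_[p] S p) := by simpa using hu
      exact PadicInt.p_nonunit (p := p) (isUnit_of_map_unit (algebraMap ℤ_[p] S) _ h1)
    intro x hx
    have := Ideal.iInf_pow_eq_bot_of_isDomain _ hne
    rw [← Ideal.mem_bot, ← this, Ideal.mem_iInf]
    intro j
    rw [Ideal.span_singleton_pow, Ideal.mem_span_singleton]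
    exact hx j
  · let I : Ideal ℤ_[p] := Ideal.span {(p : ℤ_[p]) ^ 2}
    have hI : Finite (ℤ_[p] ⧸ I) := by
      have hk := PadicInt.ker_toZModPow (p := p) 2
      have : NeZero (p ^ 2) := ⟨pow_ne_zero _ hp.out.ne_zero⟩
      change Finite (ℤ_[p] ⧸ Ideal.span {(p : ℤ_[p]) ^ 2})
      rw [← hk]
      exact Finite.of_injective _ (RingHom.kerLift_injective (PadicInt.toZModPow (p := p) 2))
    have hmap : I.map (algebraMap ℤ_[p] S) = Ideal.span {(p : S) ^ 2} := by
      rw [Ideal.map_span]; simp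
    rw [← hmap]
    have : Module.Finite (ℤ_[p] ⧸ I) (S ⧸ I.map (algebraMap ℤ_[p] S)) := inferInstance
    exact Module.finite_of_finite (ℤ_[p] ⧸ I)

theorem sml_embed (F : Set ℂ) (hF : F.Finite) : ∃ (p : ℕ) (S : Type) (_ : CommRing S) (_ : IsDomain S)
    (_ : CharZero S) (φ : Subring.closure F →+* S), Function.Injective φ ∧
    (∀ k : ℕ, ((k.factorial : ℕ) : S) ∣ (p : S) ^ k) ∧
    (∀ x : S, (∀ j : ℕ, (p : S) ^ j ∣ x) → x = 0) ∧ Finite (S ⧸ Ideal.span {(p : S) ^ 2}) := by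
  let A := Algebra.adjoin ℚ F
  have : Algebra.FiniteType ℚ A :=
    (Subalgebra.fg_iff_finiteType _).1 (Subalgebra.fg_def.2 ⟨F, hF, rfl⟩)
  obtain ⟨s, g, hg, hgi⟩ := exists_integral_inj_algHom_of_fg ℚ A
  let : Algebra (MvPolynomial (Fin s) ℤ) (MvPolynomial (Fin s) ℚ) := MvPolynomial.algebraMvPolynomial
  let : Algebra (MvPolynomial (Fin s) ℚ) ℂ := (A.val.comp g).toRingHom.toAlgebra
  let : Algebra (MvPolynomial (Fin s) ℤ) ℂ :=
    ((algebraMap (MvPolynomial (Fin s) ℚ) ℂ).comp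
      (algebraMap (MvPolynomial (Fin s) ℤ) (MvPolynomial (Fin s) ℚ))).toAlgebra
  have : IsScalarTower (MvPolynomial (Fin s) ℤ) (MvPolynomial (Fin s) ℚ) ℂ :=
    IsScalarTower.of_algebraMap_eq' rfl
  have hGinj : Function.Injective (algebraMap (MvPolynomial (Fin s) ℤ) ℂ) := by
    have h1 : Function.Injective (algebraMap (MvPolynomial (Fin s) ℚ) ℂ) :=
      Subtype.val_injective.comp hg
    have h2 : Function.Injective (algebraMap (MvPolynomial (Fin s) ℤ) (MvPolynomial (Fin s) ℚ)) :=
      MvPolynomial.map_injective _ (Int.cast_injective)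
    exact h1.comp h2
  have hint : ∀ y ∈ F, ∃ m : ℤ, m ≠ 0 ∧ IsIntegral (MvPolynomial (Fin s) ℤ) ((m : ℂ) * y) := by
    intro y hy
    have h1 : IsIntegral (MvPolynomial (Fin s) ℚ) y := by
      obtain ⟨P, hP, hP2⟩ := hgi ⟨y, Algebra.subset_adjoin hy⟩
      refine ⟨P, hP, ?_⟩
      have := congrArg A.val hP2
      rw [map_zero] at this
      rw [← this]
      have h2 := (hom_eval₂ P g.toRingHom A.val.toRingHom ⟨y, Algebra.subset_adjoin hy⟩).symm
      exact h2
    obtain ⟨⟨_, m, hm, rfl⟩, hmi⟩ := IsIntegral.exists_multiple_integral_of_isLocalization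
      (R := MvPolynomial (Fin s) ℤ) ((nonZeroDivisors ℤ).map (MvPolynomial.C (σ := Fin s))) y h1
    refine ⟨m, nonZeroDivisors.ne_zero hm, ?_⟩
    rw [Submonoid.smul_def, Algebra.smul_def] at hmi
    have e : algebraMap (MvPolynomial (Fin s) ℤ) ℂ (MvPolynomial.C m) = (m : ℂ) := by
      rw [eq_intCast (MvPolynomial.C (σ := Fin s) (R := ℤ)) m, map_intCast]
    rw [← e]
    exact hmi
  choose! m hm0 hmi using hint
  obtain ⟨p, hpge, hp⟩ := Nat.exists_infinite_primes ((∏ y ∈ hF.toFinset, (m y).natAbs) + 1)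
  have : Fact p.Prime := ⟨hp⟩
  have hpm : ∀ y ∈ F, ¬ p ∣ (m y).natAbs := by
    intro y hy hd
    have h1 : p ∣ ∏ y ∈ hF.toFinset, (m y).natAbs :=
      hd.trans (Finset.dvd_prod_of_mem (fun y => (m y).natAbs) (hF.mem_toFinset.2 hy))
    have h2 : 0 < ∏ y ∈ hF.toFinset, (m y).natAbs :=
      Finset.prod_pos fun y hy => Int.natAbs_pos.2 (hm0 y (hF.mem_toFinset.1 hy))
    have := Nat.le_of_dvd h2 h1
    omega
  obtain ⟨τ, hτ⟩ := sml_algInd p s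
  let Ω := AlgebraicClosure ℚ_[p]
  let : Algebra (MvPolynomial (Fin s) ℤ) ℤ_[p] := (MvPolynomial.aeval τ).toRingHom.toAlgebra
  let : Algebra (MvPolynomial (Fin s) ℤ) Ω :=
    ((algebraMap ℤ_[p] Ω).comp (algebraMap (MvPolynomial (Fin s) ℤ) ℤ_[p])).toAlgebra
  have : IsScalarTower (MvPolynomial (Fin s) ℤ) ℤ_[p] Ω := IsScalarTower.of_algebraMap_eq' rfl
  have hpΩ : Function.Injective (algebraMap ℤ_[p] Ω) := by
    rw [IsScalarTower.algebraMap_eq ℤ_[p] ℚ_[p] Ω]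
    exact (algebraMap ℚ_[p] Ω).injective.comp (IsFractionRing.injective ℤ_[p] ℚ_[p])
  have hΩinj : Function.Injective (algebraMap (MvPolynomial (Fin s) ℤ) Ω) := by
    have h1 : Function.Injective (algebraMap (MvPolynomial (Fin s) ℤ) ℤ_[p]) := hτ
    exact hpΩ.comp h1
  let R0 := Subalgebra.algebraicClosure (MvPolynomial (Fin s) ℤ) ℂ
  have : FaithfulSMul (MvPolynomial (Fin s) ℤ) Ω := (faithfulSMul_iff_algebraMap_injective _ _).2 hΩinj
  have hR0inj : Function.Injective (algebraMap (MvPolynomial (Fin s) ℤ) R0) := by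
    intro x y hxy
    have h := congrArg R0.val hxy
    exact hGinj h
  have : FaithfulSMul (MvPolynomial (Fin s) ℤ) R0 := (faithfulSMul_iff_algebraMap_injective _ _).2 hR0inj
  let ψ : R0 →ₐ[MvPolynomial (Fin s) ℤ] Ω := IsAlgClosed.lift
  have hψ : Function.Injective ψ := by
    rw [injective_iff_map_eq_zero]
    intro x hx
    by_contra hx0
    apply Ideal.comap_ne_bot_of_algebraic_mem (R := MvPolynomial (Fin s) ℤ) (I := RingHom.ker ψ) hx0 hx
      (Algebra.IsAlgebraic.isAlgebraic x)
    rw [eq_bot_iff]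
    intro z hz
    have hz' : ψ (algebraMap _ _ z) = 0 := hz
    rw [AlgHom.commutes] at hz'
    exact hΩinj (by rw [hz', map_zero])
  have hFR : ∀ y ∈ F, y ∈ R0 := by
    intro y hy
    change IsAlgebraic _ y
    have h1 := (hmi y hy).isAlgebraic
    refine IsAlgebraic.of_mul (mem_nonZeroDivisors_of_ne_zero (Int.cast_ne_zero.2 (hm0 y hy))) ?_ h1
    exact isAlgebraic_intCast _
  have hψint : ∀ y (hy : y ∈ F), IsIntegral ℤ_[p] (ψ ⟨y, hFR y hy⟩) := by
    intro y hy
    have h1 : IsIntegral (MvPolynomial (Fin s) ℤ) (((m y : ℤ) : R0) * ⟨y, hFR y hy⟩) := by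
      rw [← isIntegral_algHom_iff R0.val Subtype.val_injective]
      simpa using hmi y hy
    have h2 : IsIntegral ℤ_[p] (ψ (((m y : ℤ) : R0) * ⟨y, hFR y hy⟩)) := (h1.map ψ).tower_top
    rw [map_mul, map_intCast] at h2
    have hu : IsUnit ((m y : ℤ) : ℤ_[p]) := by
      have := sml_natUnit p _ (hpm y hy)
      rw [PadicInt.isUnit_iff] at this ⊢
      rw [← this]
      rcases Int.natAbs_eq (m y) with h | h <;> rw [h] <;> simp
    obtain ⟨w, hw⟩ := hu.exists_left_inv
    have h3 := (isIntegral_algebraMap (R := ℤ_[p]) (A := Ω) (x := w)).mul h2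
    rw [← mul_assoc, ← map_intCast (algebraMap ℤ_[p] Ω), ← map_mul, hw, map_one, one_mul] at h3
    exact h3
  let F' : Set Ω := ψ '' (Subtype.val ⁻¹' F)
  have hF' : F'.Finite := (hF.preimage Subtype.val_injective.injOn).image _
  let S := Algebra.adjoin ℤ_[p] F'
  have : Module.Finite ℤ_[p] S := Module.Finite.of_fg (fg_adjoin_of_finite hF' (by
    rintro _ ⟨y, hy, rfl⟩
    exact hψint y.1 hy))
  have hle : Subring.closure F ≤ R0.toSubring := Subring.closure_le.2 hFR
  have hS : ∀ x (hx : x ∈ Subring.closure F), ψ ⟨x, hle hx⟩ ∈ S := by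
    intro x hx
    induction hx using Subring.closure_induction with
    | mem x hx => exact Algebra.subset_adjoin ⟨⟨x, hFR x hx⟩, hx, rfl⟩
    | zero => exact (map_zero ψ).symm ▸ S.zero_mem
    | one => exact (map_one ψ).symm ▸ S.one_mem
    | add x y hx hy h1 h2 =>
      have := S.add_mem h1 h2
      rw [← map_add] at this
      exact this
    | neg x hx h1 =>
      have := S.neg_mem h1
      rw [← map_neg] at this
      exact this
    | mul x y hx hy h1 h2 =>
      have := S.mul_mem h1 h2
      rw [← map_mul] at this
      exact this
  let φ : Subring.closure F →+* S :=
    (ψ.toRingHom.comp (Subring.inclusion hle)).codRestrict S (fun x => hS x.1 x.2)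
  have hSinj : Function.Injective (algebraMap ℤ_[p] S) := by
    intro x y hxy
    exact hpΩ (congrArg Subtype.val hxy)
  obtain ⟨hc, h1, h2, h3⟩ := sml_local p S hSinj
  refine ⟨p, S, inferInstance, inferInstance, hc, φ, ?_, h1, h2, h3⟩
  intro x y hxy
  have := hψ (congrArg Subtype.val hxy)
  exact Subring.inclusion_injective hle this

theorem nondegenerate_finitely_many_zeros (d : ℕ) (a : Fin d → ℂ) (ha : ∀ h : 0 < d, a ⟨0, h⟩ ≠ 0)
    (Xs : ℕ → ℂ)
    (hrec : ∀ n : ℕ, Xs (n + d) = ∑ i : Fin d, a i * Xs (n + i))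
    (hnonzero : ∃ n : ℕ, Xs n ≠ 0)
    (hND : ∀ lam mu : ℂ,
      (X ^ d - ∑ i : Fin d, C (a i) * X ^ (i : ℕ)).IsRoot lam →
      (X ^ d - ∑ i : Fin d, C (a i) * X ^ (i : ℕ)).IsRoot mu →
      lam ≠ mu → ∀ n : ℕ, 0 < n → (lam / mu) ^ n ≠ 1) :
    {n : ℕ | Xs n = 0}.Finite := by
  by_contra hinf
  rcases Nat.eq_zero_or_pos d with hd0 | hd
  · subst hd0
    obtain ⟨n, hn⟩ := hnonzero
    apply hn
    simpa using hrec n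
  let F : Set ℂ := Set.range a ∪ {(a ⟨0, hd⟩)⁻¹} ∪ (Xs '' Set.Iio d)
  have hF : F.Finite :=
    ((Set.finite_range a).union (Set.finite_singleton _)).union ((Set.finite_Iio d).image Xs)
  obtain ⟨p, S, _, _, _, φ, hφ, hfac, hsep, hfin⟩ := sml_embed F hF
  have haF : ∀ i, a i ∈ Subring.closure F := fun i =>
    Subring.subset_closure (Or.inl (Or.inl ⟨i, rfl⟩))
  have hiF : (a ⟨0, hd⟩)⁻¹ ∈ Subring.closure F :=
    Subring.subset_closure (Or.inl (Or.inr rfl))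
  have hXF : ∀ n, Xs n ∈ Subring.closure F := by
    intro n
    induction n using Nat.strong_induction_on with
    | _ n ih =>
      rcases lt_or_ge n d with h | h
      · exact Subring.subset_closure (Or.inr ⟨n, h, rfl⟩)
      · obtain ⟨k, rfl⟩ := Nat.exists_eq_add_of_le' h
        rw [hrec]
        exact sum_mem fun i _ => mul_mem (haF i) (ih _ (by omega))
  obtain ⟨N, r, hN, hz⟩ := sml_progression p hfac hsep hfin d (fun i => φ ⟨a i, haF i⟩) hd
    (by
      refine IsUnit.of_mul_eq_one (φ ⟨_, hiF⟩) ?_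
      rw [← map_mul, ← map_one φ]
      congr 1
      exact Subtype.ext (mul_inv_cancel₀ (ha hd)))
    (fun n => φ ⟨Xs n, hXF n⟩)
    (by
      intro n
      simp only [← map_mul, ← map_sum]
      congr 1
      apply Subtype.ext
      simpa using hrec n)
    (by
      refine Set.Infinite.mono ?_ hinf
      intro n hn
      have h0 : (⟨Xs n, hXF n⟩ : Subring.closure F) = 0 := Subtype.ext hn
      change φ _ = 0
      rw [h0, map_zero])
  refine sml_nondeg d a ha Xs hrec hnonzero hND N r hN fun n => ?_
  have h0 := hφ ((hz n).trans (map_zero φ).symm)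
  exact congrArg Subtype.val h0
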